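/- arXiv:2212.11748 — 3 statements merged into one kernel-verified Lean document; each statement's English description precedes it below -/
import Mathlib

section
/- Let T be a nondegenerate tetrahedron and define the bubble space 𝔅₃(T) = { v ∈ P₃(T) : ∫_F v q ds = 0 for all q ∈ P₁(F) and all faces F of T }. Then dim 𝔅₃(T) = 8. -/
open MeasureTheory MvPolynomial
open scoped RealInnerProductSpace

noncomputable section

/-- Euclidean 3-space. -/
abbrev E3 := EuclideanSpace ℝ (Fin 3)

/-- Evaluate a polynomial in 3 variables at a point of `E3`. -/
def evalP (x : E3) (p : MvPolynomial (Fin 3) ℝ) : ℝ :=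
  MvPolynomial.eval (fun j => x j) p

/-- The (closed) facet of the tetrahedron opposite to vertex `i`. -/
def face (a : Fin 4 → E3) (i : Fin 4) : Set E3 :=
  convexHull ℝ (a '' {j | j ≠ i})

/-- The (closed) tetrahedron with vertices `a`. -/
def tetra (a : Fin 4 → E3) : Set E3 :=
  convexHull ℝ (Set.range a)

/-- The reference triangle. -/
def refTri : Set (ℝ × ℝ) := {u | 0 ≤ u.1 ∧ 0 ≤ u.2 ∧ u.1 + u.2 ≤ 1}

lemma refTri_isClosed : IsClosed refTri := by
  have h1 : IsClosed {u : ℝ × ℝ | 0 ≤ u.1} := isClosed_le (by fun_prop) (by fun_prop)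
  have h2 : IsClosed {u : ℝ × ℝ | 0 ≤ u.2} := isClosed_le (by fun_prop) (by fun_prop)
  have h3 : IsClosed {u : ℝ × ℝ | u.1 + u.2 ≤ 1} := isClosed_le (by fun_prop) (by fun_prop)
  exact h1.inter (h2.inter h3)

lemma refTri_isCompact : IsCompact refTri := by
  refine (isCompact_Icc (a := ((0 : ℝ), (0 : ℝ))) (b := (1, 1))).of_isClosed_subset
    refTri_isClosed ?_
  rintro ⟨x, y⟩ ⟨h1, h2, h3⟩
  simp only at h1 h2 h3
  exact ⟨⟨h1, h2⟩, ⟨by simp only; linarith, by simp only; linarith⟩⟩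

lemma beta_aux (c : ℕ) : ∀ (b : ℕ) (s : ℝ), ∫ y in (0 : ℝ)..s, y ^ b * (s - y) ^ c
    = s ^ (b + c + 1) * (b.factorial * c.factorial / (b + c + 1).factorial) := by
  induction c with
  | zero =>
    intro b s
    simp [Nat.factorial_succ]
    have := Nat.factorial_ne_zero b
    field_simp
  | succ c ih =>
    intro b s
    have e : ∀ y : ℝ, y ^ b * (s - y) ^ (c + 1)
        = s * (y ^ b * (s - y) ^ c) - y ^ (b + 1) * (s - y) ^ c := by intro y; ring
    simp_rw [e]
    rw [intervalIntegral.integral_sub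
      (Continuous.intervalIntegrable (by fun_prop) _ _)
      (Continuous.intervalIntegrable (by fun_prop) _ _),
      intervalIntegral.integral_const_mul, ih, ih]
    have h1 : b + 1 + c + 1 = (b + c + 1) + 1 := by ring
    have h2 : b + (c + 1) + 1 = (b + c + 1) + 1 := by ring
    rw [h1, h2, Nat.factorial_succ (b + c + 1), Nat.factorial_succ b, Nat.factorial_succ c]
    have := Nat.factorial_ne_zero (b + c + 1)
    push_cast
    field_simp
    ring

lemma tri_integral (f : ℝ × ℝ → ℝ) (hf : Continuous f) :
    ∫ u in refTri, f u = ∫ x in (0 : ℝ)..1, ∫ y in (0 : ℝ)..(1 - x), f (x, y) := by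
  have hint : IntegrableOn f refTri := hf.continuousOn.integrableOn_compact refTri_isCompact
  rw [← integral_indicator refTri_isClosed.measurableSet, Measure.volume_eq_prod,
    integral_prod _ ((integrable_indicator_iff refTri_isClosed.measurableSet).2 hint),
    intervalIntegral.integral_of_le zero_le_one, ← integral_Icc_eq_integral_Ioc,
    ← integral_indicator measurableSet_Icc]
  congr 1
  ext x
  by_cases hx : x ∈ Set.Icc (0 : ℝ) 1
  · rw [Set.indicator_of_mem hx, intervalIntegral.integral_of_le (by linarith [hx.2]),
      ← integral_Icc_eq_integral_Ioc, ← integral_indicator measurableSet_Icc]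
    congr 1
    ext y
    by_cases hy : y ∈ Set.Icc (0 : ℝ) (1 - x)
    · rw [Set.indicator_of_mem hy, Set.indicator_of_mem]
      exact ⟨hx.1, hy.1, by simp only; linarith [hy.2]⟩
    · rw [Set.indicator_of_notMem hy, Set.indicator_of_notMem]
      rintro ⟨h1, h2, h3⟩
      simp only at h1 h2 h3
      exact hy ⟨h2, by linarith⟩
  · rw [Set.indicator_of_notMem hx]
    rw [← integral_zero ℝ ℝ (μ := volume)]
    congr 1
    ext y
    rw [Set.indicator_of_notMem]
    rintro ⟨h1, h2, h3⟩
    simp only at h1 h2 h3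
    exact hx ⟨h1, by linarith⟩

/-- Barycentric coordinates on the reference triangle. -/
def bc (u : ℝ × ℝ) : Fin 3 → ℝ := ![u.1, u.2, 1 - u.1 - u.2]

lemma bc_continuous (k : Fin 3) : Continuous fun u => bc u k := by
  fin_cases k <;> simp [bc] <;> fun_prop

lemma tri_moment (α : Fin 3 → ℕ) :
    ∫ u in refTri, ∏ k, bc u k ^ α k
      = (∏ k, ((α k).factorial : ℝ)) / ((∑ k, α k) + 2).factorial := by
  have hc : Continuous fun u => ∏ k, bc u k ^ α k := by
    have := bc_continuous
    fun_prop
  rw [tri_integral _ hc]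
  simp only [Fin.prod_univ_three, Fin.sum_univ_three, bc]
  generalize α 0 = a
  generalize α 1 = b
  generalize α 2 = c
  simp only [Matrix.cons_val_zero, Matrix.cons_val_one, Matrix.cons_val]
  simp_rw [mul_assoc, intervalIntegral.integral_const_mul, beta_aux c b]
  simp_rw [← mul_assoc]
  rw [intervalIntegral.integral_mul_const, beta_aux]
  have h1 : a + (b + c + 1) + 1 = a + b + c + 2 := by ring
  rw [h1]
  have := Nat.factorial_ne_zero (b + c + 1)
  field_simp
  simp

/-- Parametrization of a triangle. -/
def par (b : Fin 3 → E3) (u : ℝ × ℝ) : E3 := ∑ k, bc u k • b k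

lemma par_face (b : Fin 3 → E3) : par b '' refTri = convexHull ℝ (Set.range b) := by
  have h1 : bc '' refTri = stdSimplex ℝ (Fin 3) := by
    ext w
    constructor
    · rintro ⟨⟨x, y⟩, ⟨h1, h2, h3⟩, rfl⟩
      simp only at h1 h2 h3
      refine ⟨fun k => ?_, by simp [bc, Fin.sum_univ_three]⟩
      fin_cases k <;> simp [bc] <;> linarith
    · rintro ⟨h1, h2⟩
      rw [Fin.sum_univ_three] at h2
      refine ⟨(w 0, w 1), ⟨h1 0, h1 1, by simp only; linarith [h1 2]⟩, ?_⟩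
      ext k
      fin_cases k <;> simp [bc]
      linarith
  let l : (Fin 3 → ℝ) →ₗ[ℝ] E3 := ∑ k, (LinearMap.proj (R := ℝ) k).smulRight (b k)
  have h2 : par b = l ∘ bc := by
    ext1 u
    simp [par, l]
  rw [h2, Set.image_comp, h1, ← convexHull_rangle_single_eq_stdSimplex,
    LinearMap.image_convexHull, ← Set.range_comp]
  congr 2
  ext1 k
  simp [l, Pi.single_apply]

def lpar (b : Fin 3 → E3) : ℝ × ℝ →ₗ[ℝ] E3 :=
  (LinearMap.fst ℝ ℝ ℝ).smulRight (b 0 - b 2) + (LinearMap.snd ℝ ℝ ℝ).smulRight (b 1 - b 2)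

lemma par_eq (b : Fin 3 → E3) (u : ℝ × ℝ) : par b u = lpar b u + b 2 := by
  simp [par, lpar, bc, Fin.sum_univ_three]
  module

lemma lpar_inj (b : Fin 3 → E3) (hb : AffineIndependent ℝ b) : Function.Injective (lpar b) := by
  rw [← LinearMap.ker_eq_bot, LinearMap.ker_eq_bot']
  rintro ⟨x, y⟩ h
  have := (affineIndependent_iff.1 hb) Finset.univ ![x, y, - x - y] (by simp [Fin.sum_univ_three])
    (by
      simp [Fin.sum_univ_three]
      simp [lpar] at h
      rw [← h]; module)
  have h0 := this 0 (Finset.mem_univ _)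
  have h1 := this 1 (Finset.mem_univ _)
  simp at h0 h1
  simp [h0, h1]

lemma comap_haar (l : ℝ × ℝ →ₗ[ℝ] E3) (hl : Function.Injective l) (v : E3) :
    ∃ c : ENNReal, c ≠ 0 ∧ c ≠ ⊤ ∧
      (μH[2] : Measure E3).comap (fun u => l u + v) = c • (volume : Measure (ℝ × ℝ)) := by
  have hcont : Continuous l := l.continuous_of_finiteDimensional
  obtain ⟨K, hK0, hK⟩ := l.exists_antilipschitzWith (LinearMap.ker_eq_bot.2 hl)
  have hLip := (LinearMap.toContinuousLinearMap l).lipschitz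
  have hinj : Function.Injective (fun u => l u + v) := fun x y h => hl (by simpa using h)
  have hemb : MeasurableEmbedding (fun u => l u + v) :=
    Continuous.measurableEmbedding (by fun_prop) hinj
  set ν := (μH[2] : Measure E3).comap (fun u => l u + v) with hν
  have hνa : ∀ s, ν s = μH[2] (l '' s) := by
    intro s
    rw [hν, hemb.comap_apply]
    have : (fun u => l u + v) '' s = (IsometryEquiv.addRight v) '' (l '' s) := by
      rw [Set.image_image]; rfl
    rw [this, IsometryEquiv.hausdorffMeasure_image]
  have hinv : ν.IsAddLeftInvariant := by
    refine ⟨fun g => ?_⟩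
    ext s hs
    rw [Measure.map_apply (measurable_const_add g) hs, hνa, hνa]
    have : l '' s = (IsometryEquiv.addLeft (l g)) '' (l '' ((fun x => g + x) ⁻¹' s)) := by
      rw [Set.image_image]
      ext z
      constructor
      · rintro ⟨w, hw, rfl⟩
        refine ⟨-g + w, by simpa using hw, by simp⟩
      · rintro ⟨w, hw, rfl⟩
        exact ⟨g + w, hw, by simp⟩
    rw [this, IsometryEquiv.hausdorffMeasure_image]
  have hcube : IsCompact (Set.Icc ((0 : ℝ), (0 : ℝ)) (1, 1)) := isCompact_Icc
  have hvol : volume (Set.Icc ((0 : ℝ), (0 : ℝ)) (1, 1)) = 1 := by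
    rw [← Set.Icc_prod_Icc, Measure.volume_eq_prod, Measure.prod_prod]; simp
  have hint : (interior (Set.Icc ((0 : ℝ), (0 : ℝ)) (1, 1))).Nonempty := by
    rw [← Set.Icc_prod_Icc, interior_prod_eq, interior_Icc]
    exact ⟨(1/2, 1/2), by constructor <;> constructor <;> norm_num⟩
  have hhaar : ν.IsAddHaarMeasure := by
    refine Measure.isAddHaarMeasure_of_isCompact_nonempty_interior ν _ hcube hint ?_ ?_
    · intro h0
      rw [hνa] at h0
      have := hK.le_hausdorffMeasure_image (d := 2) (by norm_num) (Set.Icc ((0 : ℝ), (0 : ℝ)) (1, 1))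
      rw [h0, hausdorffMeasure_prod_real, hvol] at this
      simp at this
    · rw [hνa]
      have := hLip.hausdorffMeasure_image_le (d := 2) (by norm_num) (Set.Icc ((0 : ℝ), (0 : ℝ)) (1, 1))
      rw [hausdorffMeasure_prod_real, hvol] at this
      refine ne_top_of_le_ne_top ?_ this
      simp
  refine ⟨ν.addHaarScalarFactor volume, ?_, ENNReal.coe_ne_top, ?_⟩
  · have := Measure.addHaarScalarFactor_pos_of_isAddHaarMeasure ν volume
    simpa using this.ne'
  · exact Measure.isAddLeftInvariant_eq_smul ν volume

lemma face_integral (b : Fin 3 → E3) (hb : AffineIndependent ℝ b) :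
    ∃ c : ℝ, c ≠ 0 ∧ ∀ f : E3 → ℝ, ∫ x in convexHull ℝ (Set.range b), f x ∂(μH[2])
      = c * ∫ u in refTri, f (par b u) := by
  obtain ⟨c, h0, ht, hc⟩ := comap_haar (lpar b) (lpar_inj b hb) (b 2)
  have hpar : (fun u => lpar b u + b 2) = par b := by ext1 u; rw [par_eq]
  rw [hpar] at hc
  have hinj : Function.Injective (par b) := by
    rw [← hpar]; exact fun x y h => lpar_inj b hb (by simpa using h)
  have hcont : Continuous (par b) := by
    rw [← hpar]
    have := (lpar b).continuous_of_finiteDimensional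
    fun_prop
  have hemb : MeasurableEmbedding (par b) := hcont.measurableEmbedding hinj
  refine ⟨c.toReal, ENNReal.toReal_ne_zero.2 ⟨h0, ht⟩, fun f => ?_⟩
  have h1 := hemb.setIntegral_map (μ := (μH[2] : Measure E3).comap (par b)) f (par b '' refTri)
  rw [hemb.map_comap, hc, Set.preimage_image_eq _ hinj, Measure.restrict_smul,
    integral_smul_measure, Measure.restrict_restrict
      (hemb.measurableSet_image.2 refTri_isClosed.measurableSet),
    Set.inter_eq_left.2 (Set.image_subset_range _ _), par_face] at h1
  simpa using h1

lemma evalP_affine (q : MvPolynomial (Fin 3) ℝ) (hq : q.totalDegree ≤ 1) (b : Fin 3 → E3)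
    (u : ℝ × ℝ) : evalP (par b u) q = ∑ k, bc u k * evalP (b k) q := by
  have hsum : ∑ k, bc u k = 1 := by simp [bc, Fin.sum_univ_three]
  simp only [evalP, eval_eq', Finset.mul_sum]
  rw [Finset.sum_comm]
  refine Finset.sum_congr rfl fun d hd => ?_
  have hd1 : ∑ j, d j ≤ 1 := by
    have := (le_totalDegree hd).trans hq
    rwa [Finsupp.sum_fintype _ _ (fun _ => rfl)] at this
  have key : ∏ j, (par b u) j ^ d j = ∑ k, bc u k * ∏ j, (b k) j ^ d j := by
    rw [Fin.sum_univ_three] at hd1 hsum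
    have hcases : (d 0 = 0 ∧ d 1 = 0 ∧ d 2 = 0) ∨ (d 0 = 1 ∧ d 1 = 0 ∧ d 2 = 0) ∨
      (d 0 = 0 ∧ d 1 = 1 ∧ d 2 = 0) ∨ (d 0 = 0 ∧ d 1 = 0 ∧ d 2 = 1) := by omega
    rcases hcases with ⟨h0, h1, h2⟩ | ⟨h0, h1, h2⟩ | ⟨h0, h1, h2⟩ | ⟨h0, h1, h2⟩ <;>
      simp [Fin.prod_univ_three, Fin.sum_univ_three, h0, h1, h2, par, hsum]
  rw [key, Finset.mul_sum]
  refine Finset.sum_congr rfl fun k _ => ?_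
  ring

lemma exists_bary (a : Fin 4 → E3) (hind : AffineIndependent ℝ a) :
    ∃ lam : Fin 4 → MvPolynomial (Fin 3) ℝ, (∀ m, (lam m).totalDegree ≤ 1) ∧
      ∀ m j, evalP (a j) (lam m) = if m = j then 1 else 0 := by
  have htop : affineSpan ℝ (Set.range a) = ⊤ := by
    rw [hind.affineSpan_eq_top_iff_card_eq_finrank_add_one]
    simp
  let B : AffineBasis (Fin 4) ℝ E3 := ⟨a, hind, htop⟩
  refine ⟨fun m => C (B.coord m 0) + ∑ j, C ((B.coord m).linear (EuclideanSpace.single j 1)) * X j,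
    fun m => ?_, fun m j => ?_⟩
  · refine (totalDegree_add _ _).trans (max_le (by simp) ?_)
    refine (totalDegree_finsetSum _ _).trans (Finset.sup_le fun j _ => ?_)
    refine (totalDegree_mul _ _).trans ?_
    rw [totalDegree_C, totalDegree_X]
  · have h1 : evalP (a j) (C (B.coord m 0) +
        ∑ j, C ((B.coord m).linear (EuclideanSpace.single j 1)) * X j) = B.coord m (a j) := by
      have h2 : a j = ∑ k, (a j) k • (EuclideanSpace.single k (1 : ℝ) : E3) := by
        ext l
        simp [Pi.single_apply]
      have h3 : B.coord m (a j) = (B.coord m).linear (a j) + B.coord m 0 := by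
        have := (B.coord m).map_vadd 0 (a j)
        simpa using this
      rw [h3]
      conv_rhs => rw [h2]
      simp [evalP, mul_comm, add_comm]
    rw [h1]
    exact B.coord_apply m j

lemma finrank_cubic : Module.finrank ℝ (restrictTotalDegree (Fin 3) ℝ 3) = 20 := by
  change Module.finrank ℝ
    (restrictSupport ℝ {n : Fin 3 →₀ ℕ | (n.sum fun _ e => e) ≤ 3}) = 20
  rw [Module.finrank_eq_nat_card_basis
    (basisRestrictSupport ℝ {n : Fin 3 →₀ ℕ | (n.sum fun _ e => e) ≤ 3})]
  have e : {n : Fin 3 →₀ ℕ | (n.sum fun _ e => e) ≤ 3} ≃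
      {f : Fin 3 → Fin 4 // (f 0 : ℕ) + f 1 + f 2 ≤ 3} :=
    { toFun := fun n => ⟨fun j => ⟨n.1 j, by
          have := n.2
          simp only [Set.mem_ofPred_eq] at this
          rw [Finsupp.sum_fintype _ _ (fun _ => rfl), Fin.sum_univ_three] at this
          fin_cases j <;> simp <;> omega⟩, by
          have := n.2
          simp only [Set.mem_ofPred_eq] at this
          rw [Finsupp.sum_fintype _ _ (fun _ => rfl), Fin.sum_univ_three] at this
          simpa using this⟩
      invFun := fun f => ⟨Finsupp.equivFunOnFinite.symm (fun j => (f.1 j : ℕ)), by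
          simp only [Set.mem_ofPred_eq]
          rw [Finsupp.sum_fintype _ _ (fun _ => rfl), Fin.sum_univ_three]
          simpa using f.2⟩
      left_inv := fun n => by ext j; simp
      right_inv := fun f => by ext j; simp }
  rw [Nat.card_congr e, Nat.card_eq_fintype_card]
  decide +kernel

/-- Vertices of the face opposite to vertex `i`. -/
def fv (a : Fin 4 → E3) (i : Fin 4) (k : Fin 3) : E3 := a (i.succAbove k)

lemma face_eq (a : Fin 4 → E3) (i : Fin 4) : face a i = convexHull ℝ (Set.range (fv a i)) := by
  unfold face
  congr 1
  have : {j | j ≠ i} = Set.range i.succAbove := by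
    rw [Fin.range_succAbove]; rfl
  rw [this, ← Set.range_comp]
  rfl

lemma evalP_continuous (p : MvPolynomial (Fin 3) ℝ) (b : Fin 3 → E3) :
    Continuous fun u => evalP (par b u) p := by
  have h := bc_continuous
  have h2 : Continuous (par b) := by unfold par; fun_prop
  exact (MvPolynomial.continuous_eval p).comp (by fun_prop)

/-- The moment map. -/
def momentMap (a : Fin 4 → E3) :
    restrictTotalDegree (Fin 3) ℝ 3 →ₗ[ℝ] (Fin 4 × Fin 3 → ℝ) where
  toFun p ik := ∫ u in refTri, evalP (par (fv a ik.1) u) p.1 * bc u ik.2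
  map_add' p q := by
    ext ik
    have hi : ∀ r : MvPolynomial (Fin 3) ℝ,
        IntegrableOn (fun u => evalP (par (fv a ik.1) u) r * bc u ik.2) refTri := fun r =>
      ((evalP_continuous r _).mul (bc_continuous _)).continuousOn.integrableOn_compact
        refTri_isCompact
    simp only [Pi.add_apply]
    rw [← integral_add (hi _) (hi _)]
    congr 1
    ext u
    simp [evalP, add_mul]
  map_smul' c p := by
    ext ik
    simp only [Pi.smul_apply, smul_eq_mul, RingHom.id_apply]
    rw [← integral_const_mul]
    congr 1
    ext u
    simp [evalP, mul_assoc]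

lemma momentMap_prod (a : Fin 4 → E3) (lam : Fin 4 → MvPolynomial (Fin 3) ℝ)
    (hdeg : ∀ m, (lam m).totalDegree ≤ 1)
    (hlam : ∀ m j, evalP (a j) (lam m) = if m = j then 1 else 0)
    (β : Fin 4 → ℕ) (i : Fin 4) (k : Fin 3) :
    ∫ u in refTri, evalP (par (fv a i) u) (∏ m, lam m ^ β m) * bc u k
      = if β i = 0 then (∏ l, (((β (i.succAbove l) + if l = k then 1 else 0).factorial : ℕ) : ℝ))
          / (((∑ l, β (i.succAbove l)) + 3).factorial : ℕ) else 0 := by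
  have h1 : ∀ u, evalP (par (fv a i) u) (lam i) = 0 := by
    intro u
    rw [evalP_affine _ (hdeg i)]
    refine Finset.sum_eq_zero fun l _ => ?_
    simp [fv, hlam, (Fin.succAbove_ne i l).symm]
  have h2 : ∀ u l, evalP (par (fv a i) u) (lam (i.succAbove l)) = bc u l := by
    intro u l
    rw [evalP_affine _ (hdeg _)]
    simp [fv, hlam]
  have h3 : ∀ u, evalP (par (fv a i) u) (∏ m, lam m ^ β m) * bc u k
      = 0 ^ β i * ∏ l, bc u l ^ (β (i.succAbove l) + if l = k then 1 else 0) := by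
    intro u
    have : evalP (par (fv a i) u) (∏ m, lam m ^ β m)
        = ∏ m, (evalP (par (fv a i) u) (lam m)) ^ β m := by simp [evalP]
    rw [this, Fin.prod_univ_succAbove _ i, h1]
    simp only [h2, pow_add, Finset.prod_mul_distrib, mul_assoc]
    congr 2
    simp
  simp_rw [h3]
  rw [integral_const_mul, tri_moment]
  split_ifs with h
  · simp [h, Finset.sum_add_distrib, add_assoc]
  · simp [h]

set_option maxHeartbeats 4000000 in
lemma lin_aux (q : Fin 4 × Fin 3 → ℝ) (main : ∀ β : Fin 4 → ℕ, ∑ m, β m ≤ 3 → ∑ i, ∑ k,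
      (if β i = 0 then (∏ l, (((β (i.succAbove l) + if l = k then 1 else 0).factorial : ℕ) : ℝ))
          / (((∑ l, β (i.succAbove l)) + 3).factorial : ℕ) else 0) * q (i, k) = 0) :
    ∀ ik, q ik = 0 := by
  have e1 := main ![0, 1, 1, 1] (by decide)
  have e2 := main ![1, 0, 1, 1] (by decide)
  have e3 := main ![1, 1, 0, 1] (by decide)
  have e4 := main ![1, 1, 1, 0] (by decide)
  have e5 := main ![2, 1, 0, 0] (by decide)
  have e6 := main ![2, 0, 1, 0] (by decide)
  have e7 := main ![2, 0, 0, 1] (by decide)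
  have e8 := main ![1, 2, 0, 0] (by decide)
  have e9 := main ![0, 2, 1, 0] (by decide)
  have e10 := main ![0, 2, 0, 1] (by decide)
  have e11 := main ![1, 0, 2, 0] (by decide)
  have e12 := main ![0, 1, 2, 0] (by decide)
  have e13 := main ![0, 0, 2, 1] (by decide)
  have e14 := main ![1, 0, 0, 2] (by decide)
  have e15 := main ![0, 1, 0, 2] (by decide)
  have e16 := main ![0, 0, 1, 2] (by decide)
  clear main
  simp [Fin.sum_univ_succ, Fin.prod_univ_succ, Fin.succAbove, Nat.factorial] at e1 e2 e3 e4 e5 e6 e7 e8 e9 e10 e11 e12 e13 e14 e15 e16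
  rintro ⟨i, k⟩
  fin_cases i <;> fin_cases k <;> simp <;> linarith

lemma momentMap_surj (a : Fin 4 → E3) (hind : AffineIndependent ℝ a) :
    LinearMap.range (momentMap a) = ⊤ := by
  obtain ⟨lam, hdeg, hlam⟩ := exists_bary a hind
  by_contra hne
  obtain ⟨f, hf0, hf⟩ := Submodule.exists_le_ker_of_lt_top _ (lt_top_iff_ne_top.2 hne)
  apply hf0
  set q : Fin 4 × Fin 3 → ℝ := fun ik => f (fun j => if ik = j then 1 else 0) with hq
  have hfq : ∀ w, f w = ∑ i, ∑ k, w (i, k) * q (i, k) := by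
    intro w
    rw [LinearMap.pi_apply_eq_sum_univ f w, Fintype.sum_prod_type]
    rfl
  have main : ∀ β : Fin 4 → ℕ, ∑ m, β m ≤ 3 → ∑ i, ∑ k,
      (if β i = 0 then (∏ l, (((β (i.succAbove l) + if l = k then 1 else 0).factorial : ℕ) : ℝ))
          / (((∑ l, β (i.succAbove l)) + 3).factorial : ℕ) else 0) * q (i, k) = 0 := by
    intro β hβ
    have hmem : ∏ m, lam m ^ β m ∈ restrictTotalDegree (Fin 3) ℝ 3 := by
      rw [mem_restrictTotalDegree]
      refine (totalDegree_finsetProd _ _).trans (le_trans (Finset.sum_le_sum fun m _ => ?_) hβ)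
      refine (totalDegree_pow _ _).trans ?_
      simpa using Nat.mul_le_mul_left (β m) (hdeg m)
    have := hf ⟨⟨_, hmem⟩, rfl⟩
    rw [LinearMap.mem_ker, hfq] at this
    refine Eq.trans ?_ this
    refine Finset.sum_congr rfl fun i _ => Finset.sum_congr rfl fun k _ => ?_
    rw [← momentMap_prod a lam hdeg hlam β i k]
    rfl
  have hz := lin_aux q main
  refine LinearMap.ext fun w => ?_
  rw [hfq]
  simp [hz]

/-- the cubic bubble space `𝔅₃(T)` has dimension `8`. -/
theorem stmt3 (a : Fin 4 → E3) (hind : AffineIndependent ℝ a) :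
    Set.finrank ℝ {p : MvPolynomial (Fin 3) ℝ | p.totalDegree ≤ 3 ∧
      ∀ (i : Fin 4) (q : MvPolynomial (Fin 3) ℝ), q.totalDegree ≤ 1 →
        ∫ x in face a i, evalP x p * evalP x q ∂(μH[2]) = 0} = 8 := by
  obtain ⟨lam, hdeg, hlam⟩ := exists_bary a hind
  have hset : {p : MvPolynomial (Fin 3) ℝ | p.totalDegree ≤ 3 ∧
      ∀ (i : Fin 4) (q : MvPolynomial (Fin 3) ℝ), q.totalDegree ≤ 1 →
        ∫ x in face a i, evalP x p * evalP x q ∂(μH[2]) = 0}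
      = ((LinearMap.ker (momentMap a)).map (restrictTotalDegree (Fin 3) ℝ 3).subtype : Set _) := by
    ext p
    have hfi : ∀ i, ∃ c : ℝ, c ≠ 0 ∧ ∀ f : E3 → ℝ, ∫ x in face a i, f x ∂(μH[2])
        = c * ∫ u in refTri, f (par (fv a i) u) := by
      intro i
      rw [face_eq]
      exact face_integral _ (hind.comp_embedding (Fin.succAboveEmb i))
    constructor
    · rintro ⟨hp, h⟩
      refine ⟨⟨p, (mem_restrictTotalDegree _ _ _).2 hp⟩, ?_, rfl⟩
      rw [SetLike.mem_coe, LinearMap.mem_ker]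
      ext ⟨i, k⟩
      obtain ⟨c, hc, hf⟩ := hfi i
      have h1 := h i (lam (i.succAbove k)) (hdeg _)
      rw [hf] at h1
      have h2 := (mul_eq_zero.1 h1).resolve_left hc
      have h3 : ∀ u, evalP (par (fv a i) u) (lam (i.succAbove k)) = bc u k := by
        intro u
        rw [evalP_affine _ (hdeg _)]
        simp [fv, hlam]
      simp only [h3] at h2
      exact h2
    · rintro ⟨⟨p, hp⟩, hk, rfl⟩
      rw [SetLike.mem_coe, LinearMap.mem_ker] at hk
      refine ⟨(mem_restrictTotalDegree _ _ _).1 hp, fun i q hq => ?_⟩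
      obtain ⟨c, hc, hf⟩ := hfi i
      rw [hf]
      simp only [Submodule.subtype_apply, evalP_affine q hq, Finset.mul_sum]
      rw [integral_finsetSum, Finset.sum_eq_zero, mul_zero]
      · intro k _
        simp_rw [← mul_assoc]
        rw [integral_mul_const]
        have : ∫ u in refTri, evalP (par (fv a i) u) p * bc u k = 0 := congrFun hk (i, k)
        rw [this, zero_mul]
      · intro k _
        exact ((evalP_continuous p _).mul
          ((bc_continuous k).mul continuous_const)).continuousOn.integrableOn_compact
          refTri_isCompact
  rw [hset, Set.finrank, Submodule.span_eq]
  have h1 := LinearMap.finrank_range_add_finrank_ker (momentMap a)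
  rw [momentMap_surj a hind, finrank_top, finrank_cubic] at h1
  simp only [Module.finrank_fintype_fun_eq_card, Fintype.card_prod, Fintype.card_fin] at h1
  rw [Submodule.finrank_map_subtype_eq]
  omega
end
end

section
/- On a nondegenerate tetrahedron T, for each i ∈ {1,2,3,4} the polynomial φᵢ = 14λᵢ⁴ − 21λᵢ³ + 9λᵢ² − λᵢ satisfies ∫_F φᵢ q ds = 0 for every face F of T and every polynomial q of degree at most 2 on F. -/
open MeasureTheory MvPolynomial
open scoped RealInnerProductSpace

noncomputable section

/-- reference triangle -/
def Tri6 : Set (ℝ × ℝ) := {z | 0 ≤ z.1 ∧ 0 ≤ z.2 ∧ z.1 + z.2 ≤ 1}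

/-- parametrization -/
def par6 (p0 u v : E3) (z : ℝ × ℝ) : E3 := p0 + (z.1 • u + z.2 • v)

def lin6 (u v : E3) : (ℝ × ℝ) →ₗ[ℝ] E3 :=
  (LinearMap.fst ℝ ℝ ℝ).smulRight u + (LinearMap.snd ℝ ℝ ℝ).smulRight v

lemma lin6_apply (u v : E3) (z : ℝ × ℝ) : lin6 u v z = z.1 • u + z.2 • v := by
  simp [lin6]

lemma lin6_inj (u v : E3) (h : LinearIndependent ℝ ![u, v]) :
    Function.Injective (lin6 u v) := by
  rw [← LinearMap.ker_eq_bot, LinearMap.ker_eq_bot']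
  intro z hz
  rw [lin6_apply] at hz
  have := LinearIndependent.pair_iff.1 h _ _ hz
  exact Prod.ext this.1 this.2

lemma hull6 (p0 p1 p2 : E3) :
    convexHull ℝ {p0, p1, p2} = par6 p0 (p1 - p0) (p2 - p0) '' Tri6 := by
  apply Set.Subset.antisymm
  · apply convexHull_min
    · rintro x (rfl | rfl | rfl)
      · exact ⟨(0, 0), by simp [Tri6], by simp [par6]⟩
      · exact ⟨(1, 0), by simp [Tri6], by simp [par6]⟩
      · exact ⟨(0, 1), by simp [Tri6], by simp [par6]⟩
    · rintro _ ⟨z, ⟨h1, h2, h3⟩, rfl⟩ _ ⟨w, ⟨k1, k2, k3⟩, rfl⟩ a b ha hb hab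
      refine ⟨a • z + b • w, ⟨?_, ?_, ?_⟩, ?_⟩
      · simp; positivity
      · simp; positivity
      · simp; nlinarith
      · obtain rfl : b = 1 - a := by linarith
        simp only [par6, Prod.fst_add, Prod.snd_add, Prod.smul_fst, Prod.smul_snd, smul_eq_mul]
        module
  · rintro _ ⟨z, ⟨h1, h2, h3⟩, rfl⟩
    have := (convex_convexHull ℝ ({p0, p1, p2} : Set E3)).sum_mem (t := Finset.univ)
      (w := ![1 - z.1 - z.2, z.1, z.2]) (z := ![p0, p1, p2])
      (by intro i _; fin_cases i <;> simp <;> linarith)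
      (by simp [Fin.sum_univ_three]; ring)
      (by intro i _; apply subset_convexHull; fin_cases i <;> simp)
    convert this using 1
    simp only [par6, Fin.sum_univ_three, Matrix.cons_val]
    module

lemma par6_emb (p0 u v : E3) (h : LinearIndependent ℝ ![u, v]) :
    Topology.IsClosedEmbedding (par6 p0 u v) := by
  have h1 := LinearMap.isClosedEmbedding_of_injective (f := lin6 u v)
    (LinearMap.ker_eq_bot.2 (lin6_inj u v h))
  have h2 := (Homeomorph.addLeft p0).isClosedEmbedding.comp h1
  convert h2 using 1
  ext z : 1
  simp [par6, lin6_apply]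

lemma meas6 (p0 u v : E3) (h : LinearIndependent ℝ ![u, v]) :
    ∃ c : NNReal, (μH[2] : Measure E3).restrict (Set.range (par6 p0 u v)) =
      c • Measure.map (par6 p0 u v) volume := by
  let V := LinearMap.range (lin6 u v)
  let e : (ℝ × ℝ) ≃L[ℝ] V := (LinearEquiv.ofInjective _ (lin6_inj u v h)).toContinuousLinearEquiv
  have hfr : Module.finrank ℝ V = 2 := by
    rw [← e.toLinearEquiv.finrank_eq]; simp
  have hH : (μH[2] : Measure V).IsAddHaarMeasure := by
    have := MeasureTheory.isAddHaarMeasure_hausdorffMeasure (E := V)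
    rw [hfr] at this
    exact_mod_cast this
  have hM : (Measure.map e (volume : Measure (ℝ × ℝ))).IsAddHaarMeasure :=
    e.isAddHaarMeasure_map _
  let c := Measure.addHaarScalarFactor (μH[2] : Measure V) (Measure.map e volume)
  have hc : (μH[2] : Measure V) = c • Measure.map e volume :=
    Measure.isAddLeftInvariant_eq_smul _ _
  let ι : V → E3 := fun w => p0 + (w : E3)
  have hι : Isometry ι := (IsometryEquiv.addLeft p0).isometry.comp isometry_subtype_coe
  have hcomp : par6 p0 u v = ι ∘ e := by
    ext z : 1
    simp [par6, ι, e, lin6_apply]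
  have hr : Set.range (par6 p0 u v) = Set.range ι := by
    rw [hcomp, e.surjective.range_comp]
  refine ⟨c, ?_⟩
  rw [hr, ← hι.map_hausdorffMeasure (Or.inl (by norm_num)), hc, hcomp,
    ← Measure.map_map hι.continuous.measurable e.continuous.measurable]
  rw [Measure.map_smul]

lemma int6 (p0 p1 p2 : E3) (h : LinearIndependent ℝ ![p1 - p0, p2 - p0]) :
    ∃ c : NNReal, ∀ f : E3 → ℝ, ∫ x in convexHull ℝ {p0, p1, p2}, f x ∂(μH[2]) =
      c * ∫ z in Tri6, f (par6 p0 (p1 - p0) (p2 - p0) z) := by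
  obtain ⟨c, hc⟩ := meas6 p0 _ _ h
  refine ⟨c, fun f => ?_⟩
  have he := par6_emb p0 _ _ h
  rw [hull6, ← Measure.restrict_restrict_of_subset (Set.image_subset_range _ Tri6), hc,
    Measure.restrict_smul, integral_smul_nnreal_measure,
    he.measurableEmbedding.setIntegral_map, he.injective.preimage_image]
  rfl

lemma triint6 (g : ℝ × ℝ → ℝ) (hg : Continuous g) :
    ∫ z in Tri6, g z = ∫ s in (0:ℝ)..1, ∫ t in (0:ℝ)..(1 - s), g (s, t) := by
  have hcl : IsClosed Tri6 := by
    unfold Tri6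
    simp only [Set.ofPred_and]
    exact (isClosed_le (by fun_prop) (by fun_prop)).inter
      ((isClosed_le (by fun_prop) (by fun_prop)).inter (isClosed_le (by fun_prop) (by fun_prop)))
  have hcpt : IsCompact Tri6 := by
    apply (isCompact_Icc (a := ((0:ℝ),(0:ℝ))) (b := (1,1))).of_isClosed_subset hcl
    rintro ⟨s, t⟩ ⟨h1, h2, h3⟩
    simp only at h1 h2 h3
    exact ⟨⟨h1, h2⟩, ⟨by simp; linarith, by simp; linarith⟩⟩
  have hint : Integrable (Tri6.indicator g) :=
    (integrable_indicator_iff hcl.measurableSet).2 (hg.continuousOn.integrableOn_compact hcpt)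
  rw [← integral_indicator hcl.measurableSet, Measure.volume_eq_prod, integral_prod _ hint,
    intervalIntegral.integral_of_le zero_le_one, ← integral_Icc_eq_integral_Ioc,
    ← integral_indicator measurableSet_Icc]
  congr 1
  ext s
  by_cases hs : s ∈ Set.Icc (0:ℝ) 1
  · rw [Set.indicator_of_mem hs, intervalIntegral.integral_of_le (by linarith [hs.2]),
      ← integral_Icc_eq_integral_Ioc, ← integral_indicator measurableSet_Icc]
    congr 1
    ext t
    simp only [Set.indicator, Tri6, Set.mem_ofPred_eq, Set.mem_Icc]
    have := hs.1
    congr 1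
    apply propext
    constructor
    · rintro ⟨a, b, c⟩; exact ⟨b, by linarith⟩
    · rintro ⟨b, c⟩; exact ⟨this, b, by linarith⟩
  · rw [Set.indicator_of_notMem hs]
    rw [← integral_zero ℝ ℝ (μ := volume)]
    congr 1
    ext t
    apply Set.indicator_of_notMem
    rintro ⟨a, b, c⟩
    simp only at a b c
    exact hs ⟨a, by linarith⟩

/-- Final reference computation. -/
lemma ref6 (c0 c1 c2 c3 c4 c5 : ℝ) :
    ∫ z in Tri6, (14 * z.1 ^ 4 - 21 * z.1 ^ 3 + 9 * z.1 ^ 2 - z.1) *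
      (c0 + c1 * z.1 + c2 * z.2 + c3 * z.1 ^ 2 + c4 * (z.1 * z.2) + c5 * z.2 ^ 2) = 0 := by
  rw [triint6 _ (by fun_prop)]
  have h1 : ∀ s : ℝ, ∫ t in (0:ℝ)..(1 - s), (14 * s ^ 4 - 21 * s ^ 3 + 9 * s ^ 2 - s) *
      (c0 + c1 * s + c2 * t + c3 * s ^ 2 + c4 * (s * t) + c5 * t ^ 2) =
      (14 * s ^ 4 - 21 * s ^ 3 + 9 * s ^ 2 - s) * (c0 * (1 - s) + c1 * s * (1 - s)
        + c2 * (1 - s) ^ 2 / 2 + c3 * s ^ 2 * (1 - s) + c4 * s * (1 - s) ^ 2 / 2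
        + c5 * (1 - s) ^ 3 / 3) := by
    intro s
    rw [intervalIntegral.integral_eq_sub_of_hasDerivAt (f := fun t =>
      (14 * s ^ 4 - 21 * s ^ 3 + 9 * s ^ 2 - s) * (c0 * t + c1 * s * t
        + c2 * t ^ 2 / 2 + c3 * s ^ 2 * t + c4 * s * t ^ 2 / 2 + c5 * t ^ 3 / 3))]
    · ring
    · intro t _
      have e1 := hasDerivAt_id t
      have e2 := hasDerivAt_pow 2 t
      have e3 := hasDerivAt_pow 3 t
      convert! ((((((e1.const_mul c0).add (e1.const_mul (c1 * s))).add
        ((e2.const_mul c2).div_const 2)).add (e1.const_mul (c3 * s ^ 2))).add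
        ((e2.const_mul (c4 * s)).div_const 2)).add ((e3.const_mul c5).div_const 3)).const_mul
        (14 * s ^ 4 - 21 * s ^ 3 + 9 * s ^ 2 - s) using 1
      norm_num
      ring_nf
      simp
    · apply Continuous.intervalIntegrable; fun_prop
  simp only [h1]
  have hp : ∀ n : ℕ, ∀ s : ℝ, HasDerivAt (fun s : ℝ => s ^ (n + 1) / (n + 1)) (s ^ n) s := by
    intro n s
    have := (hasDerivAt_pow (n + 1) s).div_const (n + 1 : ℝ)
    convert! this using 1
    have : (n + 1 : ℝ) ≠ 0 := by positivity
    push_cast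
    field_simp
  have hpoly : ∀ s : ℝ, (14 * s ^ 4 - 21 * s ^ 3 + 9 * s ^ 2 - s) * (c0 * (1 - s)
        + c1 * s * (1 - s)
        + c2 * (1 - s) ^ 2 / 2 + c3 * s ^ 2 * (1 - s) + c4 * s * (1 - s) ^ 2 / 2
        + c5 * (1 - s) ^ 3 / 3)
      = (c0 + c2 / 2 + c5 / 3) * (- s ^ 1 + 10 * s ^ 2 - 30 * s ^ 3 + 35 * s ^ 4 - 14 * s ^ 5)
      + (c1 - c2 / 2 + c4 / 2 - 2 * c5 / 3) *
        (- s ^ 2 + 10 * s ^ 3 - 30 * s ^ 4 + 35 * s ^ 5 - 14 * s ^ 6)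
      + (c3 - c4 / 2 + c5 / 3) *
        (- s ^ 3 + 10 * s ^ 4 - 30 * s ^ 5 + 35 * s ^ 6 - 14 * s ^ 7) := by
    intro s; ring
  simp only [hpoly]
  have hmon : ∀ k : ℕ, ∀ s : ℝ, HasDerivAt (fun s : ℝ => - (s ^ (k + 1 + 1) / ((k + 1 : ℕ) + 1))
      + 10 * (s ^ (k + 2 + 1) / ((k + 2 : ℕ) + 1)) - 30 * (s ^ (k + 3 + 1) / ((k + 3 : ℕ) + 1))
      + 35 * (s ^ (k + 4 + 1) / ((k + 4 : ℕ) + 1)) - 14 * (s ^ (k + 5 + 1) / ((k + 5 : ℕ) + 1)))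
      (- s ^ (k + 1) + 10 * s ^ (k + 2) - 30 * s ^ (k + 3) + 35 * s ^ (k + 4)
        - 14 * s ^ (k + 5)) s := by
    intro k s
    exact (((((hp (k + 1) s).neg).add ((hp (k + 2) s).const_mul 10)).sub
      ((hp (k + 3) s).const_mul 30)).add ((hp (k + 4) s).const_mul 35)).sub
      ((hp (k + 5) s).const_mul 14)
  rw [intervalIntegral.integral_eq_sub_of_hasDerivAt (fun s _ =>
    (((hmon 0 s).const_mul (c0 + c2 / 2 + c5 / 3)).add
      ((hmon 1 s).const_mul (c1 - c2 / 2 + c4 / 2 - 2 * c5 / 3))).add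
      ((hmon 2 s).const_mul (c3 - c4 / 2 + c5 / 3)))]
  · norm_num
  · apply Continuous.intervalIntegrable; fun_prop

/-- functions which are quadratic polynomials in two variables -/
def Quad6 (f : ℝ × ℝ → ℝ) : Prop := ∃ c0 c1 c2 c3 c4 c5 : ℝ, ∀ z,
  f z = c0 + c1 * z.1 + c2 * z.2 + c3 * z.1 ^ 2 + c4 * (z.1 * z.2) + c5 * z.2 ^ 2

def Aff6 (f : ℝ × ℝ → ℝ) : Prop := ∃ c0 c1 c2 : ℝ, ∀ z, f z = c0 + c1 * z.1 + c2 * z.2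

lemma Aff6.mul {f g : ℝ × ℝ → ℝ} (hf : Aff6 f) (hg : Aff6 g) : Quad6 (fun z => f z * g z) := by
  obtain ⟨a, b, c, h⟩ := hf
  obtain ⟨a', b', c', h'⟩ := hg
  exact ⟨a * a', a * b' + a' * b, a * c' + a' * c, b * b', b * c' + b' * c, c * c',
    fun z => by simp only [h, h']; ring⟩

lemma Aff6.one : Aff6 (fun _ => 1) := ⟨1, 0, 0, fun z => by ring⟩

lemma Aff6.sum {ι : Type*} (S : Finset ι) (k : ι → ℝ) (f : ι → ℝ × ℝ → ℝ)
    (h : ∀ i ∈ S, Aff6 (f i)) : Aff6 (fun z => ∑ i ∈ S, k i * f i z) := by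
  classical
  induction S using Finset.induction_on with
  | empty => exact ⟨0, 0, 0, fun z => by simp⟩
  | insert i S hi ih =>
    obtain ⟨a, b, c, h1⟩ := h i (by simp)
    obtain ⟨a', b', c', h2⟩ := ih (fun j hj => h j (by simp [hj]))
    exact ⟨k i * a + a', k i * b + b', k i * c + c', fun z => by
      simp only [Finset.sum_insert hi]
      have h3 := h2 z
      simp only at h3
      rw [h3, h1]; ring⟩

lemma Quad6.sum {ι : Type*} (S : Finset ι) (k : ι → ℝ) (f : ι → ℝ × ℝ → ℝ)
    (h : ∀ i ∈ S, Quad6 (f i)) : Quad6 (fun z => ∑ i ∈ S, k i * f i z) := by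
  classical
  induction S using Finset.induction_on with
  | empty => exact ⟨0, 0, 0, 0, 0, 0, fun z => by simp⟩
  | insert i S hi ih =>
    obtain ⟨a, b, c, d, e, f, h1⟩ := h i (by simp)
    obtain ⟨a', b', c', d', e', f', h2⟩ := ih (fun j hj => h j (by simp [hj]))
    exact ⟨k i * a + a', k i * b + b', k i * c + c', k i * d + d', k i * e + e', k i * f + f',
      fun z => by
      simp only [Finset.sum_insert hi]
      have h3 := h2 z
      simp only at h3
      rw [h3, h1]; ring⟩

lemma par6_coord (p0 u v : E3) (j : Fin 3) : Aff6 (fun z => par6 p0 u v z j) :=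
  ⟨p0 j, u j, v j, fun z => by simp [par6]; ring⟩

lemma evalP_eq6 (x : E3) (q : MvPolynomial (Fin 3) ℝ) :
    evalP x q = ∑ m ∈ q.support, q.coeff m * (x 0 ^ m 0 * x 1 ^ m 1 * x 2 ^ m 2) := by
  rw [evalP, MvPolynomial.eval_eq']
  simp [Fin.prod_univ_three]

lemma deg6 (q : MvPolynomial (Fin 3) ℝ) (n : ℕ) (hq : q.totalDegree ≤ n) (m : Fin 3 →₀ ℕ)
    (hm : m ∈ q.support) : m 0 + m 1 + m 2 ≤ n := by
  have := (MvPolynomial.le_totalDegree hm).trans hq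
  rw [Finsupp.sum_fintype _ _ (by simp)] at this
  simpa [Fin.sum_univ_three] using this

lemma lin_par6 (p0 u v : E3) (q : MvPolynomial (Fin 3) ℝ) (hq : q.totalDegree ≤ 1) :
    Aff6 (fun z => evalP (par6 p0 u v z) q) := by
  simp only [evalP_eq6]
  apply Aff6.sum
  intro m hm
  have hd := deg6 q 1 hq m hm
  have A := par6_coord p0 u v
  generalize m 0 = a at *
  generalize m 1 = b at *
  generalize m 2 = c at *
  have ha : a ≤ 1 := by omega
  have hb : b ≤ 1 := by omega
  have hc : c ≤ 1 := by omega
  interval_cases a <;> interval_cases b <;> interval_cases c <;> first | omega | skip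
  all_goals simp only [pow_zero, pow_one, one_mul, mul_one]
  all_goals first | exact Aff6.one | exact A _

lemma quad_par6 (p0 u v : E3) (q : MvPolynomial (Fin 3) ℝ) (hq : q.totalDegree ≤ 2) :
    Quad6 (fun z => evalP (par6 p0 u v z) q) := by
  simp only [evalP_eq6]
  apply Quad6.sum
  intro m hm
  have hd := deg6 q 2 hq m hm
  have A := par6_coord p0 u v
  generalize m 0 = a at *
  generalize m 1 = b at *
  generalize m 2 = c at *
  have ha : a ≤ 2 := by omega
  have hb : b ≤ 2 := by omega
  have hc : c ≤ 2 := by omega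
  interval_cases a <;> interval_cases b <;> interval_cases c <;> first | omega | skip
  all_goals simp only [pow_zero, pow_one, one_mul, mul_one, pow_two]
  all_goals first
    | exact (A _).mul (A _)
    | simpa using (A 0).mul Aff6.one
    | simpa using (A 1).mul Aff6.one
    | simpa using (A 2).mul Aff6.one
    | simpa using Aff6.one.mul Aff6.one

lemma idx6 : ∀ i F : Fin 4, ∃ m j k : Fin 4, (i = F ∨ m = i) ∧ j ≠ m ∧ j ≠ k ∧ m ≠ k ∧
    ∀ l, l ≠ F ↔ (l = j ∨ l = m ∨ l = k) := by
  decide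

/-- the quartic bubbles `φᵢ = 14λᵢ⁴ − 21λᵢ³ + 9λᵢ² − λᵢ` have
vanishing second-order moments on every facet. -/
theorem stmt6 (a : Fin 4 → E3) (hind : AffineIndependent ℝ a)
    (lam : Fin 4 → MvPolynomial (Fin 3) ℝ)
    (hdeg : ∀ i, (lam i).totalDegree ≤ 1)
    (hval : ∀ i j, evalP (a j) (lam i) = if i = j then 1 else 0)
    (i : Fin 4) :
    ∀ (F : Fin 4) (q : MvPolynomial (Fin 3) ℝ), q.totalDegree ≤ 2 →
      ∫ x in face a F,
        evalP x (14 * lam i ^ 4 - 21 * lam i ^ 3 + 9 * lam i ^ 2 - lam i)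
          * evalP x q ∂(μH[2]) = 0 := by
  intro F q hq
  obtain ⟨m, j, k, him, hjm, hjk, hmk, hl⟩ := idx6 i F
  have hface : face a F = convexHull ℝ {a j, a m, a k} := by
    unfold face
    congr 1
    ext x
    simp only [Set.mem_image, Set.mem_ofPred_eq, hl, Set.mem_insert_iff, Set.mem_singleton_iff]
    constructor
    · rintro ⟨l, rfl | rfl | rfl, rfl⟩ <;> simp
    · rintro (rfl | rfl | rfl)
      · exact ⟨j, by simp, rfl⟩
      · exact ⟨m, by simp, rfl⟩
      · exact ⟨k, by simp, rfl⟩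
  have hli : LinearIndependent ℝ ![a m - a j, a k - a j] := by
    have h1 := (affineIndependent_iff_linearIndependent_vsub ℝ a j).1 hind
    have h2 := h1.comp ![(⟨m, hjm.symm⟩ : {x // x ≠ j}), ⟨k, hjk.symm⟩] (by
      intro x y hxy
      fin_cases x <;> fin_cases y <;> simp_all [Subtype.ext_iff])
    convert! h2 using 1
    ext x : 1
    fin_cases x <;> simp
  obtain ⟨c, hc⟩ := int6 (a j) (a m) (a k) hli
  rw [hface, hc]
  obtain ⟨α, β, γ, hlam⟩ := lin_par6 (a j) (a m - a j) (a k - a j) (lam i) (hdeg i)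
  obtain ⟨c0, c1, c2, c3, c4, c5, hQ⟩ := quad_par6 (a j) (a m - a j) (a k - a j) q hq
  have v0 := hlam (0, 0)
  have v1 := hlam (1, 0)
  have v2 := hlam (0, 1)
  simp only [par6, zero_smul, one_smul, add_zero, zero_add, add_sub_cancel, hval, mul_zero,
    mul_one] at v0 v1 v2
  have hj := (hl j).2 (by simp)
  have hm := (hl m).2 (by simp)
  have hk := (hl k).2 (by simp)
  have hev : ∀ x, evalP x (14 * lam i ^ 4 - 21 * lam i ^ 3 + 9 * lam i ^ 2 - lam i) =
      14 * evalP x (lam i) ^ 4 - 21 * evalP x (lam i) ^ 3 + 9 * evalP x (lam i) ^ 2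
        - evalP x (lam i) := by
    intro x
    simp [evalP]
  simp only [hev, hlam, hQ]
  rcases him with rfl | rfl
  · rw [if_neg hj.symm] at v0
    rw [if_neg hm.symm] at v1
    rw [if_neg hk.symm] at v2
    obtain rfl : α = 0 := v0.symm
    obtain rfl : β = 0 := by linarith
    obtain rfl : γ = 0 := by linarith
    simp
  · rw [if_neg hjm.symm] at v0
    rw [if_pos rfl] at v1
    rw [if_neg hmk] at v2
    obtain rfl : α = 0 := v0.symm
    obtain rfl : β = 1 := by linarith
    obtain rfl : γ = 0 := by linarith
    have := ref6 c0 c1 c2 c3 c4 c5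
    simp only [zero_add, one_mul, zero_mul, add_zero]
    rw [this, mul_zero]
end
end

section
/- Let T be a nondegenerate tetrahedron and let 𝔅₃(T) = { v ∈ P₃(T) : ∫_F v q ds = 0 for all q ∈ P₁(F), all faces F }, and 𝔒₃(T) = span{ λᵢ²λⱼ, λᵢλⱼ² : 1 ≤ i < j ≤ 4 }. Then P₃(T) = 𝔅₃(T) ⊕ 𝔒₃(T) (direct sum). -/
open MeasureTheory MvPolynomial
open scoped RealInnerProductSpace

noncomputable section

/-- Polynomials of degree at most one are affine. -/
lemma deg_one_affine (q : MvPolynomial (Fin 3) ℝ) (hq : q.totalDegree ≤ 1) :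
    ∃ (b : ℝ) (c : Fin 3 → ℝ), ∀ x : E3, evalP x q = b + ∑ j, c j * x j := by
  classical
  have key : ∀ m ∈ q.support, ∃ (b : ℝ) (c : Fin 3 → ℝ), ∀ x : E3,
      evalP x (monomial m (q.coeff m)) = b + ∑ j, c j * x j := by
    intro m hm
    have h1 : (m.sum fun _ e => e) ≤ 1 := (le_totalDegree hm).trans hq
    have h1' : m.degree ≤ 1 := h1
    rcases Nat.le_one_iff_eq_zero_or_eq_one.1 h1' with h0 | h0
    · have : m = 0 := (Finsupp.degree_eq_zero_iff m).1 h0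
      subst this
      exact ⟨q.coeff 0, 0, fun x => by simp [evalP]⟩
    · obtain ⟨j, rfl⟩ : ∃ j, m = Finsupp.single j 1 := by
        exact (Finsupp.sum_eq_one_iff m).1 h0
      refine ⟨0, Pi.single j (q.coeff (Finsupp.single j 1)), fun x => ?_⟩
      simp [evalP, eval_monomial, Pi.single_apply]
  choose! b c h using key
  refine ⟨∑ m ∈ q.support, b m, fun j => ∑ m ∈ q.support, c m j, fun x => ?_⟩
  have : evalP x q = ∑ m ∈ q.support, evalP x (monomial m (q.coeff m)) := by
    unfold evalP
    conv_lhs => rw [q.as_sum]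
    rw [map_sum]
  rw [this, Finset.sum_congr rfl (fun m hm => h m hm x), Finset.sum_add_distrib, Finset.sum_comm]
  simp [Finset.sum_mul]

/-- Parametrisation of a plane through three points. -/
def phi (x y z : E3) (p : ℝ × ℝ) : E3 := x + (p.1 • (y - x) + p.2 • (z - x))

lemma deg_one_phi (q : MvPolynomial (Fin 3) ℝ) (hq : q.totalDegree ≤ 1) (x y z : E3) (p : ℝ × ℝ) :
    evalP (phi x y z p) q
      = (1 - p.1 - p.2) * evalP x q + p.1 * evalP y q + p.2 * evalP z q := by
  obtain ⟨b, c, h⟩ := deg_one_affine q hq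
  simp only [h, phi, Fin.sum_univ_three, PiLp.add_apply, PiLp.smul_apply, PiLp.sub_apply,
    smul_eq_mul]
  ring

/-- The reference triangle. -/
def tri : Set (ℝ × ℝ) := {p | 0 ≤ p.1 ∧ 0 ≤ p.2 ∧ p.1 + p.2 ≤ 1}

lemma tri_closed : IsClosed tri := by
  unfold tri
  apply IsClosed.and (isClosed_le (by fun_prop) (by fun_prop))
  apply IsClosed.and (isClosed_le (by fun_prop) (by fun_prop))
  exact (isClosed_le (by fun_prop) (by fun_prop))

lemma tri_compact : IsCompact tri := by
  apply IsCompact.of_isClosed_subset (isCompact_Icc (a := ((0 : ℝ), (0 : ℝ))) (b := (1, 1)))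
    tri_closed
  rintro ⟨s, t⟩ ⟨h1, h2, h3⟩
  simp only at h1 h2 h3
  constructor <;> constructor <;> simp <;> linarith

lemma tri_convex : Convex ℝ tri := by
  rintro ⟨s, t⟩ ⟨h1, h2, h3⟩ ⟨s', t'⟩ ⟨h1', h2', h3'⟩ α β hα hβ hab
  simp only at h1 h2 h3 h1' h2' h3'
  refine ⟨?_, ?_, ?_⟩
  · simp; positivity
  · simp; positivity
  · simp
    nlinarith

lemma tri_fubini (f : ℝ × ℝ → ℝ) (hf : Continuous f) :
    ∫ p in tri, f p = ∫ s in (0:ℝ)..1, ∫ t in (0:ℝ)..(1 - s), f (s, t) := by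
  have hm : MeasurableSet tri := tri_closed.measurableSet
  have hi : IntegrableOn f tri := hf.continuousOn.integrableOn_compact tri_compact
  rw [← integral_indicator hm, Measure.volume_eq_prod, integral_prod _
    (by rw [← Measure.volume_eq_prod]; exact hi.integrable_indicator hm),
    intervalIntegral.integral_of_le zero_le_one, ← integral_Icc_eq_integral_Ioc,
    ← integral_indicator measurableSet_Icc]
  congr 1
  ext s
  by_cases hs : s ∈ Set.Icc (0:ℝ) 1
  · rw [Set.indicator_of_mem hs, intervalIntegral.integral_of_le (by linarith [hs.2]),
      ← integral_Icc_eq_integral_Ioc, ← integral_indicator measurableSet_Icc]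
    congr 1
    ext t
    by_cases ht : t ∈ Set.Icc 0 (1 - s)
    · rw [Set.indicator_of_mem ht, Set.indicator_of_mem]
      exact ⟨hs.1, ht.1, by simp; linarith [ht.2]⟩
    · rw [Set.indicator_of_notMem ht, Set.indicator_of_notMem]
      rintro ⟨h1, h2, h3⟩
      simp only at h1 h2 h3
      exact ht ⟨h2, by linarith⟩
  · rw [Set.indicator_of_notMem hs]
    have : ∀ t, tri.indicator f (s, t) = 0 := by
      intro t
      rw [Set.indicator_of_notMem]
      rintro ⟨h1, h2, h3⟩
      simp only at h1 h2 h3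
      exact hs ⟨h1, by linarith⟩
    simp [this]

lemma face_eq_s7 (a : Fin 4 → E3) (l k i j : Fin 4)
    (h : ∀ m, m ≠ l ↔ m = k ∨ m = i ∨ m = j) :
    face a l = phi (a k) (a i) (a j) '' tri := by
  have hset : {m | m ≠ l} = {k, i, j} := by
    ext m
    simp only [Set.mem_ofPred_eq, Set.mem_insert_iff, Set.mem_singleton_iff, h m]
  unfold face
  rw [hset, Set.image_insert_eq, Set.image_insert_eq, Set.image_singleton]
  apply Set.Subset.antisymm
  · apply convexHull_min
    · rintro w (rfl | rfl | rfl)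
      · exact ⟨(0, 0), ⟨by simp, by simp, by simp⟩, by simp [phi]⟩
      · exact ⟨(1, 0), ⟨by simp, by simp, by simp⟩, by simp [phi]⟩
      · exact ⟨(0, 1), ⟨by simp, by simp, by simp⟩, by simp [phi]⟩
    · rintro _ ⟨p, hp, rfl⟩ _ ⟨q, hq, rfl⟩ α β hα hβ hab
      refine ⟨α • p + β • q, tri_convex hp hq hα hβ hab, ?_⟩
      obtain rfl : β = 1 - α := by linarith
      simp only [phi, Prod.fst_add, Prod.snd_add, Prod.smul_fst, Prod.smul_snd, smul_eq_mul]
      module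
  · rintro _ ⟨⟨s, t⟩, ⟨h1, h2, h3⟩, rfl⟩
    simp only at h1 h2 h3
    have hc := convex_convexHull ℝ ({a k, a i, a j} : Set E3)
    have hm : ∀ m ∈ ({a k, a i, a j} : Set E3), m ∈ convexHull ℝ ({a k, a i, a j} : Set E3) :=
      fun m hm => subset_convexHull ℝ _ hm
    have := hc.sum_mem (t := Finset.univ) (w := ![1 - s - t, s, t]) (z := ![a k, a i, a j])
      (by intro n _; fin_cases n <;> simp <;> linarith)
      (by simp [Fin.sum_univ_three]; ring)
      (by intro n _; fin_cases n <;> apply hm <;> simp)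
    convert this using 1
    simp [Fin.sum_univ_three, phi]
    module

lemma plane_measure (x y z : E3) (hli : LinearIndependent ℝ ![y - x, z - x]) :
    Function.Injective (phi x y z) ∧ ∃ C : NNReal, C ≠ 0 ∧
    (μH[2] : Measure E3).restrict (Set.range (phi x y z))
      = C • Measure.map (phi x y z) volume := by
  let L : (ℝ × ℝ) →ₗ[ℝ] E3 :=
    (LinearMap.fst ℝ ℝ ℝ).smulRight (y - x) + (LinearMap.snd ℝ ℝ ℝ).smulRight (z - x)
  have hL : ∀ p, L p = p.1 • (y - x) + p.2 • (z - x) := fun p => rfl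
  have hker : LinearMap.ker L = ⊥ := by
    rw [LinearMap.ker_eq_bot']
    intro p hp
    rw [hL] at hp
    have := LinearIndependent.pair_iff.1 hli p.1 p.2 hp
    exact Prod.ext this.1 this.2
  have hinj : Function.Injective L := LinearMap.ker_eq_bot.1 hker
  let V := LinearMap.range L
  let e : (ℝ × ℝ) ≃L[ℝ] V := (LinearEquiv.ofInjective L hinj).toContinuousLinearEquiv
  have he : ∀ p, ((e p : V) : E3) = L p := fun p => rfl
  have hfr : Module.finrank ℝ V = 2 := by
    rw [← e.toLinearEquiv.finrank_eq]; simp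
  let ψ : V → E3 := fun w => x + (w : E3)
  have hψ : Isometry ψ := (isometry_add_left x).comp isometry_subtype_coe
  have hφ : phi x y z = ψ ∘ e := by
    ext1 p; simp only [phi, ψ, Function.comp, he, hL]
  have hrange : Set.range (phi x y z) = Set.range ψ := by
    rw [hφ, Set.range_comp, e.surjective.range_eq, Set.image_univ]
  have hH : (μH[2] : Measure V).IsAddHaarMeasure := by
    have := MeasureTheory.isAddHaarMeasure_hausdorffMeasure (E := V)
    rw [hfr] at this
    exact_mod_cast this
  have hE : (Measure.map e (volume : Measure (ℝ × ℝ))).IsAddHaarMeasure :=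
    e.isAddHaarMeasure_map _
  have hsm := Measure.isAddLeftInvariant_eq_smul (μH[2] : Measure V) (Measure.map e volume)
  refine ⟨?_, (μH[2] : Measure V).addHaarScalarFactor (Measure.map e volume), ?_, ?_⟩
  · rw [hφ]; exact hψ.injective.comp e.injective
  · exact (Measure.addHaarScalarFactor_pos_of_isAddHaarMeasure _ _).ne'
  · rw [hrange, ← hψ.map_hausdorffMeasure (Or.inl (by norm_num)), hφ,
      ← Measure.map_map hψ.continuous.measurable e.continuous.measurable, ← Measure.map_smul,
      ← hsm]

lemma face_integral_s7 (a : Fin 4 → E3) (hind : AffineIndependent ℝ a) (l k i j : Fin 4)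
    (hki : k ≠ i) (hkj : k ≠ j) (hij : i ≠ j)
    (h : ∀ m, m ≠ l ↔ m = k ∨ m = i ∨ m = j) :
    ∃ C : ℝ, C ≠ 0 ∧ ∀ f : E3 → ℝ,
      ∫ w in face a l, f w ∂(μH[2]) = C * ∫ p in tri, f (phi (a k) (a i) (a j) p) := by
  have hli : LinearIndependent ℝ ![a i - a k, a j - a k] := by
    have h1 := (affineIndependent_iff_linearIndependent_vsub ℝ a k).1 hind
    have h2 := h1.comp (![⟨i, hki.symm⟩, ⟨j, hkj.symm⟩] : Fin 2 → {x // x ≠ k}) (by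
      intro m n hmn
      fin_cases m <;> fin_cases n <;> simp_all [eq_comm])
    have h3 : ((fun x : {x // x ≠ k} => a x -ᵥ a k) ∘
        (![⟨i, hki.symm⟩, ⟨j, hkj.symm⟩] : Fin 2 → {x // x ≠ k})) = ![a i - a k, a j - a k] := by
      funext n
      fin_cases n <;> simp
    rw [← h3]
    exact h2
  obtain ⟨hinj, C, hC, hm⟩ := plane_measure (a k) (a i) (a j) hli
  have hcont : Continuous (phi (a k) (a i) (a j)) := by unfold phi; fun_prop
  have hemb : MeasurableEmbedding (phi (a k) (a i) (a j)) :=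
    hcont.measurableEmbedding hinj
  refine ⟨C, by exact_mod_cast hC, fun f => ?_⟩
  rw [face_eq_s7 a l k i j h]
  have hr : (μH[2] : Measure E3).restrict (phi (a k) (a i) (a j) '' tri)
      = C • (Measure.map (phi (a k) (a i) (a j)) volume).restrict
          (phi (a k) (a i) (a j) '' tri) := by
    rw [← Measure.restrict_smul, ← hm, Measure.restrict_restrict_of_subset (Set.image_subset_range _ _)]
  rw [hr, integral_smul_nnreal_measure, hemb.setIntegral_map, Set.preimage_image_eq _ hinj]
  simp [NNReal.smul_def]

lemma int_quintic (e0 e1 e2 e3 e4 e5 b : ℝ) :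
    ∫ t in (0:ℝ)..b, (e0 + e1 * t + e2 * t ^ 2 + e3 * t ^ 3 + e4 * t ^ 4 + e5 * t ^ 5)
      = e0 * b + e1 * b ^ 2 / 2 + e2 * b ^ 3 / 3 + e3 * b ^ 4 / 4 + e4 * b ^ 5 / 5
        + e5 * b ^ 6 / 6 := by
  have hd : ∀ t : ℝ, HasDerivAt (fun t : ℝ => e0 * t + e1 / 2 * t ^ 2 + e2 / 3 * t ^ 3
      + e3 / 4 * t ^ 4 + e4 / 5 * t ^ 5 + e5 / 6 * t ^ 6)
      (e0 + e1 * t + e2 * t ^ 2 + e3 * t ^ 3 + e4 * t ^ 4 + e5 * t ^ 5) t := by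
    intro t
    have := ((((((hasDerivAt_id t).const_mul e0).add ((hasDerivAt_pow 2 t).const_mul (e1 / 2))).add
      ((hasDerivAt_pow 3 t).const_mul (e2 / 3))).add
      ((hasDerivAt_pow 4 t).const_mul (e3 / 4))).add
      ((hasDerivAt_pow 5 t).const_mul (e4 / 5))).add
      ((hasDerivAt_pow 6 t).const_mul (e5 / 6))
    exact this.congr_deriv (by norm_num; ring)
  rw [intervalIntegral.integral_eq_sub_of_hasDerivAt (fun t _ => hd t)
    (Continuous.intervalIntegrable (by fun_prop) _ _)]
  ring

lemma tri_moment_s7 (c1 c2 c3 c4 c5 c6 : ℝ) :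
    ∫ p in tri, (c1 * ((1 - p.1 - p.2) ^ 2 * p.1) + c2 * ((1 - p.1 - p.2) ^ 2 * p.2)
      + c3 * (p.1 ^ 2 * (1 - p.1 - p.2)) + c4 * (p.2 ^ 2 * (1 - p.1 - p.2))
      + c5 * (p.1 ^ 2 * p.2) + c6 * (p.2 ^ 2 * p.1)) * (1 - p.1 - p.2)
      = (6 * (c1 + c2) + 4 * (c3 + c4) + 2 * (c5 + c6)) / 720 := by
  rw [tri_fubini _ (by fun_prop)]
  have hin : ∀ s : ℝ, ∫ t in (0:ℝ)..(1 - s), (c1 * ((1 - s - t) ^ 2 * s)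
      + c2 * ((1 - s - t) ^ 2 * t)
      + c3 * (s ^ 2 * (1 - s - t)) + c4 * (t ^ 2 * (1 - s - t))
      + c5 * (s ^ 2 * t) + c6 * (t ^ 2 * s)) * (1 - s - t)
      = (c1 / 4 + c6 / 12) * (s * (1 - s) ^ 4) + (c2 / 20 + c4 / 30) * (1 - s) ^ 5
        + (c3 / 3 + c5 / 6) * (s ^ 2 * (1 - s) ^ 3) := by
    intro s
    have := int_quintic (c1 * s * (1 - s) ^ 3 + c3 * s ^ 2 * (1 - s) ^ 2)
      (-3 * c1 * s * (1 - s) ^ 2 + c2 * (1 - s) ^ 3 - 2 * c3 * s ^ 2 * (1 - s)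
        + c5 * s ^ 2 * (1 - s))
      (3 * c1 * s * (1 - s) - 3 * c2 * (1 - s) ^ 2 + c3 * s ^ 2 + c4 * (1 - s) ^ 2 - c5 * s ^ 2
        + c6 * s * (1 - s))
      (-c1 * s + 3 * c2 * (1 - s) - 2 * c4 * (1 - s) - c6 * s) (-c2 + c4) 0 (1 - s)
    refine Eq.trans ?_ (this.trans ?_)
    · congr 1
      ext t
      ring
    · ring
  simp only [hin]
  generalize hA : c1 / 4 + c6 / 12 = A
  generalize hB : c2 / 20 + c4 / 30 = B
  generalize hD : c3 / 3 + c5 / 6 = D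
  have := int_quintic B (A - 5 * B) (-4 * A + 10 * B + D) (6 * A - 10 * B - 3 * D)
    (-4 * A + 5 * B + 3 * D) (A - B - D) 1
  refine Eq.trans ?_ (this.trans ?_)
  · congr 1
    ext s
    ring
  · rw [← hA, ← hB, ← hD]
    ring

/-- Four pairwise distinct indices. -/
def Dist4 (l k i j : Fin 4) : Prop := l ≠ k ∧ l ≠ i ∧ l ≠ j ∧ k ≠ i ∧ k ≠ j ∧ i ≠ j

lemma Dist4.compl : ∀ {l k i j : Fin 4}, Dist4 l k i j →
    ∀ m, m ≠ l ↔ m = k ∨ m = i ∨ m = j := by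
  unfold Dist4; decide

lemma exists_dist4 : ∀ l k : Fin 4, l ≠ k → ∃ i j, Dist4 l k i j := by
  unfold Dist4; decide

lemma Dist4.sum {l k i j : Fin 4} (h : Dist4 l k i j) {M : Type*} [AddCommMonoid M]
    (g : Fin 4 → M) : ∑ m, g m = g l + (g k + (g i + g j)) := by
  have hu : (Finset.univ : Finset (Fin 4)) = {l, k, i, j} := by
    ext m
    have := h.compl m
    simp only [Finset.mem_univ, Finset.mem_insert, Finset.mem_singleton, true_iff]
    tauto
  obtain ⟨h1, h2, h3, h4, h5, h6⟩ := h
  rw [hu, Finset.sum_insert (by simp [h1, h2, h3]), Finset.sum_insert (by simp [h4, h5]),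
    Finset.sum_insert (by simp [h6]), Finset.sum_singleton]

/-- The parametrisation of the span. -/
def Oc (lam : Fin 4 → MvPolynomial (Fin 3) ℝ) :
    (Fin 4 → Fin 4 → ℝ) →ₗ[ℝ] MvPolynomial (Fin 3) ℝ where
  toFun c := ∑ m, ∑ n, if m = n then 0 else c m n • (lam m ^ 2 * lam n)
  map_add' c d := by
    simp only [← Finset.sum_add_distrib]
    refine Finset.sum_congr rfl fun m _ => Finset.sum_congr rfl fun n _ => ?_
    split_ifs
    · simp
    · simp [add_smul]
  map_smul' r c := by
    simp only [Finset.smul_sum, RingHom.id_apply]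
    refine Finset.sum_congr rfl fun m _ => Finset.sum_congr rfl fun n _ => ?_
    split_ifs
    · simp
    · simp [mul_smul]

lemma Oc_apply (lam : Fin 4 → MvPolynomial (Fin 3) ℝ) (c : Fin 4 → Fin 4 → ℝ) :
    Oc lam c = ∑ m, ∑ n, if m = n then 0 else c m n • (lam m ^ 2 * lam n) := rfl

lemma Oc_mem (lam : Fin 4 → MvPolynomial (Fin 3) ℝ) (c : Fin 4 → Fin 4 → ℝ) :
    Oc lam c ∈ Submodule.span ℝ {w : MvPolynomial (Fin 3) ℝ |
          ∃ i j : Fin 4, i < j ∧ (w = lam i ^ 2 * lam j ∨ w = lam i * lam j ^ 2)} := by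
  rw [Oc_apply]
  refine Submodule.sum_mem _ fun m _ => Submodule.sum_mem _ fun n _ => ?_
  split_ifs with h
  · exact Submodule.zero_mem _
  · apply Submodule.smul_mem
    apply Submodule.subset_span
    rcases lt_or_gt_of_ne h with h | h
    · exact ⟨m, n, h, Or.inl rfl⟩
    · exact ⟨n, m, h, Or.inr (mul_comm _ _)⟩

lemma exists_Oc (lam : Fin 4 → MvPolynomial (Fin 3) ℝ) (w : MvPolynomial (Fin 3) ℝ)
    (hw : w ∈ Submodule.span ℝ {w : MvPolynomial (Fin 3) ℝ |
          ∃ i j : Fin 4, i < j ∧ (w = lam i ^ 2 * lam j ∨ w = lam i * lam j ^ 2)}) :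
    ∃ c, Oc lam c = w := by
  have key : ∀ i j : Fin 4, i ≠ j → Oc lam (Pi.single i (Pi.single j 1)) = lam i ^ 2 * lam j := by
    intro i j hij
    rw [Oc_apply, Finset.sum_eq_single i, Finset.sum_eq_single j]
    · simp [hij]
    · intro n _ hn
      simp [hn]
    · simp
    · intro m _ hm
      apply Finset.sum_eq_zero
      intro n _
      simp [hm]
    · simp
  have hle : Submodule.span ℝ {w : MvPolynomial (Fin 3) ℝ |
          ∃ i j : Fin 4, i < j ∧ (w = lam i ^ 2 * lam j ∨ w = lam i * lam j ^ 2)}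
      ≤ LinearMap.range (Oc lam) := by
    rw [Submodule.span_le]
    rintro w ⟨i, j, hij, rfl | rfl⟩
    · exact ⟨_, key i j hij.ne⟩
    · exact ⟨_, (key j i hij.ne').trans (mul_comm _ _)⟩
  exact hle hw

lemma continuous_evalP (p : MvPolynomial (Fin 3) ℝ) : Continuous fun x : E3 => evalP x p := by
  unfold evalP
  exact (MvPolynomial.continuous_eval p).comp (by fun_prop)

lemma evalP_add (x : E3) (p q : MvPolynomial (Fin 3) ℝ) :
    evalP x (p + q) = evalP x p + evalP x q := by simp [evalP]

lemma evalP_sub (x : E3) (p q : MvPolynomial (Fin 3) ℝ) :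
    evalP x (p - q) = evalP x p - evalP x q := by simp [evalP]

lemma tri_integrable (f : ℝ × ℝ → ℝ) (hf : Continuous f) : IntegrableOn f tri :=
  hf.continuousOn.integrableOn_compact tri_compact

section Main

variable {a : Fin 4 → E3} (hind : AffineIndependent ℝ a)

lemma continuous_phi (x y z : E3) : Continuous (phi x y z) := by unfold phi; fun_prop

lemma face_fun (hind : AffineIndependent ℝ a) (l : Fin 4) (q : MvPolynomial (Fin 3) ℝ) :
    ∃ I : MvPolynomial (Fin 3) ℝ →ₗ[ℝ] ℝ,
      ∀ p, I p = ∫ x in face a l, evalP x p * evalP x q ∂(μH[2]) := by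
  obtain ⟨k, hk⟩ : ∃ k, l ≠ k := ⟨l + 1, by clear * -; revert l; decide⟩
  obtain ⟨i, j, h⟩ := exists_dist4 l k hk
  obtain ⟨C, -, hC⟩ := face_integral_s7 a hind l k i j h.2.2.2.1 h.2.2.2.2.1 h.2.2.2.2.2 h.compl
  refine ⟨{ toFun := fun p => ∫ x in face a l, evalP x p * evalP x q ∂(μH[2])
            map_add' := ?_
            map_smul' := ?_ }, fun p => rfl⟩
  · intro p p'
    have hc : ∀ p, Continuous fun w => evalP (phi (a k) (a i) (a j) w) p *
        evalP (phi (a k) (a i) (a j) w) q := fun p =>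
      ((continuous_evalP p).comp (continuous_phi _ _ _)).mul
        ((continuous_evalP q).comp (continuous_phi _ _ _))
    simp only [hC, evalP_add, add_mul]
    rw [integral_add (tri_integrable _ (hc p)) (tri_integrable _ (hc p')), mul_add]
  · intro r p
    have : ∀ x, evalP x (r • p) = r * evalP x p := fun x => by simp [evalP]
    simp only [this, mul_assoc, integral_const_mul, RingHom.id_apply, smul_eq_mul]

variable (lam : Fin 4 → MvPolynomial (Fin 3) ℝ)
    (hdeg : ∀ i, (lam i).totalDegree ≤ 1)
    (hval : ∀ i j, evalP (a j) (lam i) = if i = j then 1 else 0)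

lemma moment (hind : AffineIndependent ℝ a) (hdeg : ∀ i, (lam i).totalDegree ≤ 1)
    (hval : ∀ i j, evalP (a j) (lam i) = if i = j then 1 else 0)
    (c : Fin 4 → Fin 4 → ℝ) {l k i j : Fin 4} (h : Dist4 l k i j)
    (h0 : ∫ x in face a l, evalP x (Oc lam c) * evalP x (lam k) ∂(μH[2]) = 0) :
    6 * (c k i + c k j) + 4 * (c i k + c j k) + 2 * (c i j + c j i) = 0 := by
  have hcompl := h.compl
  have hsum := h.sum (M := MvPolynomial (Fin 3) ℝ)
  obtain ⟨h1, h2, h3, h4, h5, h6⟩ := h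
  obtain ⟨C, hC0, hC⟩ := face_integral_s7 a hind l k i j h4 h5 h6 hcompl
  have el : ∀ p, evalP (phi (a k) (a i) (a j) p) (lam l) = 0 := fun p => by
    rw [deg_one_phi _ (hdeg l)]; simp [hval, h1, h2, h3]
  have ek : ∀ p, evalP (phi (a k) (a i) (a j) p) (lam k) = 1 - p.1 - p.2 := fun p => by
    rw [deg_one_phi _ (hdeg k)]; simp [hval, h4, h5]
  have ei : ∀ p, evalP (phi (a k) (a i) (a j) p) (lam i) = p.1 := fun p => by
    rw [deg_one_phi _ (hdeg i)]; simp [hval, h4.symm, h6]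
  have ej : ∀ p, evalP (phi (a k) (a i) (a j) p) (lam j) = p.2 := fun p => by
    rw [deg_one_phi _ (hdeg j)]; simp [hval, h5.symm, h6.symm]
  have eO : ∀ p, evalP (phi (a k) (a i) (a j) p) (Oc lam c) =
      c k i * ((1 - p.1 - p.2) ^ 2 * p.1) + c k j * ((1 - p.1 - p.2) ^ 2 * p.2)
      + c i k * (p.1 ^ 2 * (1 - p.1 - p.2)) + c j k * (p.2 ^ 2 * (1 - p.1 - p.2))
      + c i j * (p.1 ^ 2 * p.2) + c j i * (p.2 ^ 2 * p.1) := by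
    intro p
    rw [Oc_apply]
    simp only [hsum, h1, h2, h3, h4, h5, h6, h1.symm, h2.symm, h3.symm, h4.symm, h5.symm,
      h6.symm, if_true, if_false]
    have esm : ∀ (x : E3) (r : ℝ) (m n : Fin 4), evalP x (r • (lam m ^ 2 * lam n))
        = r * (evalP x (lam m) ^ 2 * evalP x (lam n)) := fun x r m n => by simp [evalP]
    have e0 : ∀ x : E3, evalP x 0 = 0 := fun x => by simp [evalP]
    simp only [evalP_add, esm, e0, el, ek, ei, ej]
    ring
  rw [hC] at h0
  simp only [eO, ek] at h0
  rw [tri_moment_s7] at h0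
  have := (mul_eq_zero.1 h0).resolve_left hC0
  linarith

lemma kernel_zero (c : Fin 4 → Fin 4 → ℝ)
    (H : ∀ l k i j, Dist4 l k i j →
      6 * (c k i + c k j) + 4 * (c i k + c j k) + 2 * (c i j + c j i) = 0) :
    ∀ m n, m ≠ n → c m n = 0 := by
  have X : ∀ l k i j, Dist4 l k i j → (2 * c k i + c i k) + (2 * c k j + c j k) = 0 := by
    intro l k i j h
    have e1 := H l k i j h
    have e2 := H l i k j (by unfold Dist4 at *; tauto)
    have e3 := H l j k i (by unfold Dist4 at *; tauto)
    linarith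
  have Y : ∀ l k i j, Dist4 l k i j → 2 * c k i + c i k = 0 := by
    intro l k i j h
    have e1 := X l k i j h
    have e2 := X j k i l (by unfold Dist4 at *; tauto)
    have e3 := X i k j l (by unfold Dist4 at *; tauto)
    linarith
  intro m n hmn
  obtain ⟨i, j, h⟩ := exists_dist4 m n hmn
  have e1 := Y i m n j (by unfold Dist4 at *; tauto)
  have e2 := Y i n m j (by unfold Dist4 at *; tauto)
  linarith

lemma Oc_eq_zero (c : Fin 4 → Fin 4 → ℝ) (h : ∀ m n, m ≠ n → c m n = 0) : Oc lam c = 0 := by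
  rw [Oc_apply]
  refine Finset.sum_eq_zero fun m _ => Finset.sum_eq_zero fun n _ => ?_
  split_ifs with hmn
  · rfl
  · simp [h m n hmn]

lemma Oc_deg (hdeg : ∀ i, (lam i).totalDegree ≤ 1) (c : Fin 4 → Fin 4 → ℝ) :
    (Oc lam c).totalDegree ≤ 3 := by
  rw [Oc_apply]
  refine totalDegree_finsetSum_le fun m _ => totalDegree_finsetSum_le fun n _ => ?_
  split_ifs
  · simp
  · refine (totalDegree_smul_le _ _).trans ((totalDegree_mul _ _).trans ?_)
    have := totalDegree_pow (lam m) 2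
    have h1 := hdeg m
    have h2 := hdeg n
    omega

/-- It suffices to test against the barycentric coordinates. -/
lemma test_lam (hind : AffineIndependent ℝ a) (hdeg : ∀ i, (lam i).totalDegree ≤ 1)
    (hval : ∀ i j, evalP (a j) (lam i) = if i = j then 1 else 0)
    (b : MvPolynomial (Fin 3) ℝ) (l : Fin 4)
    (hb : ∀ k, l ≠ k → ∫ x in face a l, evalP x b * evalP x (lam k) ∂(μH[2]) = 0)
    (q : MvPolynomial (Fin 3) ℝ) (hq : q.totalDegree ≤ 1) :
    ∫ x in face a l, evalP x b * evalP x q ∂(μH[2]) = 0 := by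
  obtain ⟨k, hk⟩ : ∃ k, l ≠ k := ⟨l + 1, by clear * -; revert l; decide⟩
  obtain ⟨i, j, h⟩ := exists_dist4 l k hk
  have hcompl := h.compl
  obtain ⟨h1, h2, h3, h4, h5, h6⟩ := h
  obtain ⟨C, hC0, hC⟩ := face_integral_s7 a hind l k i j h4 h5 h6 hcompl
  have ek : ∀ p, evalP (phi (a k) (a i) (a j) p) (lam k) = 1 - p.1 - p.2 := fun p => by
    rw [deg_one_phi _ (hdeg k)]; simp [hval, h4, h5]
  have ei : ∀ p, evalP (phi (a k) (a i) (a j) p) (lam i) = p.1 := fun p => by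
    rw [deg_one_phi _ (hdeg i)]; simp [hval, h4.symm, h6]
  have ej : ∀ p, evalP (phi (a k) (a i) (a j) p) (lam j) = p.2 := fun p => by
    rw [deg_one_phi _ (hdeg j)]; simp [hval, h5.symm, h6.symm]
  have bk := hb k h1
  have bi := hb i h2
  have bj := hb j h3
  rw [hC] at bk bi bj ⊢
  simp only [ek, ei, ej] at bk bi bj
  have bk := (mul_eq_zero.1 bk).resolve_left hC0
  have bi := (mul_eq_zero.1 bi).resolve_left hC0
  have bj := (mul_eq_zero.1 bj).resolve_left hC0
  have hcb : Continuous fun p => evalP (phi (a k) (a i) (a j) p) b :=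
    (continuous_evalP b).comp (continuous_phi _ _ _)
  have hrw : ∀ p, evalP (phi (a k) (a i) (a j) p) b * evalP (phi (a k) (a i) (a j) p) q =
      (evalP (a k) q * (evalP (phi (a k) (a i) (a j) p) b * (1 - p.1 - p.2))
      + evalP (a i) q * (evalP (phi (a k) (a i) (a j) p) b * p.1))
      + evalP (a j) q * (evalP (phi (a k) (a i) (a j) p) b * p.2) := by
    intro p
    rw [deg_one_phi q hq]
    ring
  simp only [hrw]
  rw [integral_add (tri_integrable _ (by fun_prop)) (tri_integrable _ (by fun_prop)),
    integral_add (tri_integrable _ (by fun_prop)) (tri_integrable _ (by fun_prop)),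
    integral_const_mul, integral_const_mul, integral_const_mul, bk, bi, bj]
  ring

end Main

/-- the direct sum decomposition `P₃(T) = 𝔅₃(T) ⊕ 𝔒₃(T)`:
every polynomial of degree ≤ 3 is uniquely the sum of a facet-bubble and an
element of `span{λᵢ²λⱼ, λᵢλⱼ² : i < j}`. -/
theorem stmt7 (a : Fin 4 → E3) (hind : AffineIndependent ℝ a)
    (lam : Fin 4 → MvPolynomial (Fin 3) ℝ)
    (hdeg : ∀ i, (lam i).totalDegree ≤ 1)
    (hval : ∀ i j, evalP (a j) (lam i) = if i = j then 1 else 0) :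
    ∀ p : MvPolynomial (Fin 3) ℝ, p.totalDegree ≤ 3 →
      ∃! bo : MvPolynomial (Fin 3) ℝ × MvPolynomial (Fin 3) ℝ,
        (bo.1.totalDegree ≤ 3 ∧
          ∀ (i : Fin 4) (q : MvPolynomial (Fin 3) ℝ), q.totalDegree ≤ 1 →
            ∫ x in face a i, evalP x bo.1 * evalP x q ∂(μH[2]) = 0) ∧
        bo.2 ∈ Submodule.span ℝ {w : MvPolynomial (Fin 3) ℝ |
          ∃ i j : Fin 4, i < j ∧ (w = lam i ^ 2 * lam j ∨ w = lam i * lam j ^ 2)} ∧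
        p = bo.1 + bo.2 := by
  classical
  choose I hI using fun l k => face_fun hind l (lam k)
  have kz : ∀ c : Fin 4 → Fin 4 → ℝ, (∀ l k, l ≠ k → I l k (Oc lam c) = 0) →
      ∀ m n, m ≠ n → c m n = 0 := by
    intro c hc
    apply kernel_zero
    intro l k i j h
    exact moment lam hind hdeg hval c h ((hI l k _).symm.trans (hc l k h.1))
  intro p hp
  let M : (Fin 4 → Fin 4 → ℝ) →ₗ[ℝ] (Fin 4 → Fin 4 → ℝ) :=
    { toFun := fun c l k => if l = k then c l k else I l k (Oc lam c)
      map_add' := by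
        intro c d; funext l k
        by_cases h : l = k <;> simp [h]
      map_smul' := by
        intro r c; funext l k
        by_cases h : l = k <;> simp [h] }
  have hM : ∀ c l k, M c l k = if l = k then c l k else I l k (Oc lam c) := fun c l k => rfl
  have hinj : Function.Injective M := by
    rw [← LinearMap.ker_eq_bot, LinearMap.ker_eq_bot']
    intro c hc
    have hc' : ∀ l k, M c l k = 0 := fun l k => by rw [hc]; rfl
    have h0 := kz c (fun l k h => by have := hc' l k; rwa [hM, if_neg h] at this)
    funext m n
    by_cases h : m = n
    · have := hc' m n; rwa [hM, if_pos h] at this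
    · exact h0 m n h
  obtain ⟨c, hc⟩ := (LinearMap.injective_iff_surjective.1 hinj) (fun l k => I l k p)
  have hc' : ∀ l k, l ≠ k → I l k (Oc lam c) = I l k p := by
    intro l k h
    have := congrFun (congrFun hc l) k
    rwa [hM, if_neg h] at this
  refine ⟨(p - Oc lam c, Oc lam c), ⟨⟨?_, ?_⟩, Oc_mem lam c, by simp⟩, ?_⟩
  · exact (totalDegree_sub _ _).trans (max_le hp (Oc_deg lam hdeg c))
  · intro l q hq
    refine test_lam lam hind hdeg hval _ l (fun k h => ?_) q hq
    rw [← hI, map_sub, hc' l k h, sub_self]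
  · rintro ⟨b, o⟩ ⟨⟨hb1, hb2⟩, ho, hbo⟩
    simp only at hb1 hb2 ho hbo
    obtain ⟨d, rfl⟩ := exists_Oc lam o ho
    have hz : Oc lam (d - c) = 0 := by
      apply Oc_eq_zero
      apply kz
      intro l k h
      have h1 : I l k b = 0 := by rw [hI]; exact hb2 l _ (hdeg k)
      rw [map_sub, map_sub, hc' l k h, hbo, map_add, h1]
      ring
    rw [map_sub, sub_eq_zero] at hz
    rw [Prod.mk.injEq]
    exact ⟨by rw [hbo, hz]; ring, hz⟩
end
end
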